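/- Let n ≥ 3 be an integer, ρ ∈ (-1,1), and let R be a real random variable with law f_{n,ρ}. Then for every t > |ρ|/n, P(|R - ρ| > t) ≤ 1 / ((n-1)(t - |ρ|/n)²); in particular R = ρ + O_P(n^{-1/2}). -/

import Mathlib

open MeasureTheory Real

/-- Fisher's density of the sample correlation coefficient of a size-`n` sample from a
bivariate normal distribution with population correlation `ρ`. -/
noncomputable def fisherDensity (n : ℕ) (ρ : ℝ) (r : ℝ) : ℝ :=
  if |r| < 1 then
    (2 ^ ((n : ℝ) - 3) * (1 - ρ ^ 2) ^ (((n : ℝ) - 1) / 2) *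
        (1 - r ^ 2) ^ (((n : ℝ) - 4) / 2) / (π * Gamma ((n : ℝ) - 2))) *
      ∑' k : ℕ, (Gamma (((n : ℝ) - 1 + (k : ℝ)) / 2)) ^ 2 * (2 * r * ρ) ^ k / (Nat.factorial k : ℝ)
  else 0



lemma gamma_half_sq_le (y : ℝ) (hy : 0 < y) : Gamma (y + 1/2) ^ 2 ≤ y * Gamma y ^ 2 := by
  have h := Real.Gamma_mul_add_mul_le_rpow_Gamma_mul_rpow_Gamma (s := y) (t := y + 1) (a := 1/2)
    (b := 1/2) hy (by linarith) (by norm_num) (by norm_num) (by norm_num)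
  have e : (1/2 : ℝ) * y + 1/2 * (y + 1) = y + 1/2 := by ring
  rw [e, ← Real.sqrt_eq_rpow, ← Real.sqrt_eq_rpow, Real.Gamma_add_one hy.ne'] at h
  have g0 := Real.Gamma_pos_of_pos hy
  have g1 := Real.Gamma_pos_of_pos (show 0 < y + 1/2 by linarith)
  calc Gamma (y + 1/2) ^ 2 ≤ (√(Gamma y) * √(y * Gamma y)) ^ 2 := by gcongr
    _ = y * Gamma y ^ 2 := by
      rw [mul_pow, Real.sq_sqrt g0.le, Real.sq_sqrt (by positivity)]; ring

lemma gamma_half_sq_ge0 (y : ℝ) (hy : 0 < y) :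
    y ^ 2 / (y + 1/2) * Gamma y ^ 2 ≤ Gamma (y + 1/2) ^ 2 := by
  have h := gamma_half_sq_le (y + 1/2) (by linarith)
  have e : y + 1/2 + 1/2 = y + 1 := by ring
  rw [e, Real.Gamma_add_one hy.ne'] at h
  rw [div_mul_eq_mul_div, div_le_iff₀ (by linarith)]
  nlinarith

lemma gamma_watson_step (y : ℝ) (hy : 1 ≤ y) (c : ℝ) (hc : 0 ≤ c)
    (h : c * (y + 1 - 1/4) * Gamma (y + 1) ^ 2 ≤ Gamma (y + 1 + 1/2) ^ 2) :
    c * (y - 1/4) * Gamma y ^ 2 ≤ Gamma (y + 1/2) ^ 2 := by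
  have e : y + 1 + 1/2 = (y + 1/2) + 1 := by ring
  rw [e, Real.Gamma_add_one (by linarith), Real.Gamma_add_one (by linarith)] at h
  have g0 := Real.Gamma_pos_of_pos (show 0 < y by linarith)
  set G := Gamma y ^ 2 with hG
  set H := Gamma (y + 1/2) ^ 2 with hH
  have hG0 : 0 < G := by positivity
  have h' : c * (y + 1 - 1/4) * (y ^ 2 * G) ≤ (y + 1/2) ^ 2 * H := by
    calc _ = c * (y + 1 - 1/4) * (y * Gamma y) ^ 2 := by rw [hG]; ring
      _ ≤ _ := h
      _ = _ := by rw [hH]; ring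
  have h2 : (y + 1/2) ^ 2 * (c * (y - 1/4) * G) ≤ (y + 1/2) ^ 2 * H := by
    refine le_trans ?_ h'
    have : 0 ≤ c * G := by positivity
    nlinarith
  exact le_of_mul_le_mul_left h2 (by positivity)

lemma gamma_watson_aux (m : ℕ) : ∀ (y : ℝ), 1 ≤ y →
    (1 - 1 / (4 * (y + m))) * (y - 1/4) * Gamma y ^ 2 ≤ Gamma (y + 1/2) ^ 2 := by
  induction m with
  | zero =>
    intro y hy
    refine le_trans ?_ (gamma_half_sq_ge0 y (by linarith))
    gcongr
    rw [le_div_iff₀ (by linarith)]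
    have : y ≠ 0 := by linarith
    have : 1 / (4 * (y + (0:ℕ))) * y = 1/4 := by push_cast; field_simp; simp
    have h2 : 0 ≤ 1 / (4 * (y + (0:ℕ))) := by positivity
    nlinarith
  | succ m ih =>
    intro y hy
    apply gamma_watson_step y hy
    · rw [sub_nonneg, div_le_one (by positivity)]
      push_cast
      have : (0:ℝ) ≤ m := by positivity
      linarith
    · have := ih (y + 1) (by linarith)
      convert this using 4
      push_cast; ring

lemma gamma_watson (y : ℝ) (hy : 1 ≤ y) : (y - 1/4) * Gamma y ^ 2 ≤ Gamma (y + 1/2) ^ 2 := by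
  have h1 : Filter.Tendsto (fun m : ℕ => 1 / (4 * (y + (m:ℝ)))) Filter.atTop (nhds 0) := by
    apply Filter.Tendsto.const_div_atTop
    apply Filter.Tendsto.const_mul_atTop (by norm_num)
    exact Filter.tendsto_atTop_add_const_left _ _ tendsto_natCast_atTop_atTop
  have h2 : Filter.Tendsto (fun m : ℕ => (1 - 1 / (4 * (y + (m:ℝ)))) * (y - 1/4) * Gamma y ^ 2)
      Filter.atTop (nhds ((1 - 0) * (y - 1/4) * Gamma y ^ 2)) :=
    ((tendsto_const_nhds.sub h1).mul_const _).mul_const _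
  have := le_of_tendsto' h2 (fun m => gamma_watson_aux m y hy)
  simpa using this

lemma tsum_gamma_nonneg (a : ℝ) (ha : 0 < a) (d : ℕ → ℝ)
    (hd : ∀ y : ℝ, 0 ≤ ∑' k : ℕ, d k * y ^ k / (Nat.factorial k : ℝ)) (q : ℝ) :
    0 ≤ ∑' k : ℕ, (Gamma (a + k / 2) * d k) * q ^ k / (Nat.factorial k : ℝ) := by
  by_cases hs : Summable fun k : ℕ => (Gamma (a + k / 2) * d k) * q ^ k / (Nat.factorial k : ℝ)
  swap
  · rw [tsum_eq_zero_of_not_summable hs]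
  let F : ℕ → ℝ → ℝ := fun k u =>
    (Real.exp (-u) * u ^ (a + k / 2 - 1)) * (d k * q ^ k / (Nat.factorial k : ℝ))
  have hpos : ∀ k : ℕ, 0 < a + (k:ℝ) / 2 := fun k => by positivity
  have hint : ∀ k, Integrable (F k) (volume.restrict (Set.Ioi 0)) := fun k =>
    (Real.GammaIntegral_convergent (hpos k)).mul_const _
  have hval : ∀ k c, ∫ u in Set.Ioi (0:ℝ), (Real.exp (-u) * u ^ (a + (k:ℕ) / 2 - 1)) * c
      = Gamma (a + k / 2) * c := fun k c => by
    rw [integral_mul_const, ← Real.Gamma_eq_integral (hpos k)]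
  have hn : ∀ k, ∫ u in Set.Ioi (0:ℝ), ‖F k u‖ =
      ‖(Gamma (a + k / 2) * d k) * q ^ k / (Nat.factorial k : ℝ)‖ := fun k => by
    have : ‖(Gamma (a + k / 2) * d k) * q ^ k / (Nat.factorial k : ℝ)‖
        = Gamma (a + k / 2) * ‖d k * q ^ k / (Nat.factorial k : ℝ)‖ := by
      rw [mul_assoc, mul_div_assoc, norm_mul, Real.norm_of_nonneg (Gamma_pos_of_pos (hpos k)).le]
    rw [this, ← hval k]
    apply setIntegral_congr_fun measurableSet_Ioi
    intro u hu
    have hu : 0 < u := hu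
    simp only [F]
    rw [norm_mul, Real.norm_of_nonneg (by positivity)]
  have key := hasSum_integral_of_summable_integral_norm hint (by
    simp_rw [hn]; exact hs.norm)
  have e : ∀ k, ∫ u in Set.Ioi (0:ℝ), F k u =
      (Gamma (a + k / 2) * d k) * q ^ k / (Nat.factorial k : ℝ) := fun k => by
    rw [hval]; ring
  simp_rw [e] at key
  rw [key.tsum_eq]
  apply setIntegral_nonneg measurableSet_Ioi
  intro u hu
  have hu : 0 < u := hu
  have : ∀ k, F k u = (Real.exp (-u) * u ^ (a - 1)) *
      (d k * (q * √u) ^ k / (Nat.factorial k : ℝ)) := fun k => by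
    simp only [F]
    have : u ^ (a + (k:ℝ) / 2 - 1) = u ^ (a - 1) * (√u) ^ k := by
      rw [← Real.rpow_natCast, Real.sqrt_eq_rpow, ← Real.rpow_mul hu.le, ← Real.rpow_add hu]
      congr 1; ring
    rw [this, mul_pow]; ring
  simp_rw [this, tsum_mul_left]
  exact mul_nonneg (by positivity) (hd _)

lemma fisher_series_nonneg (a : ℝ) (ha : 0 < a) (q : ℝ) :
    0 ≤ ∑' k : ℕ, Gamma (a + k / 2) ^ 2 * q ^ k / (Nat.factorial k : ℝ) := by
  have h1 := tsum_gamma_nonneg a ha (fun _ => 1) (fun y => by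
    have := Real.exp_pos y
    rw [Real.exp_eq_exp_ℝ, NormedSpace.exp_eq_tsum_div] at this
    simpa using this.le)
  have h2 := tsum_gamma_nonneg a ha (fun k => Gamma (a + k / 2)) (by simpa using h1) q
  simpa [pow_two] using h2

/-- coefficients of the series -/
noncomputable def fG (a ρ : ℝ) (k : ℕ) : ℝ :=
  Gamma (a + k / 2) ^ 2 * (2 * ρ) ^ k / (Nat.factorial k : ℝ)

/-- moments of the weight -/
noncomputable def fI (a : ℝ) (j : ℕ) : ℝ :=
  ∫ r in Set.Ioo (-1 : ℝ) 1, r ^ j * (1 - r ^ 2) ^ (a - 3/2)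

lemma fG_even_succ (a ρ : ℝ) (ha : 0 < a) (j : ℕ) :
    fG a ρ (2 * (j + 1)) = (a + j) ^ 2 * (4 * ρ ^ 2) / ((2 * j + 1) * (2 * j + 2)) * fG a ρ (2 * j) := by
  unfold fG
  have e1 : a + ((2 * (j + 1) : ℕ) : ℝ) / 2 = (a + j) + 1 := by push_cast; ring
  have e2 : a + ((2 * j : ℕ) : ℝ) / 2 = a + j := by push_cast; ring
  rw [e1, e2, Real.Gamma_add_one (by positivity), show 2 * (j + 1) = 2 * j + 1 + 1 by ring,
    Nat.factorial_succ, Nat.factorial_succ]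
  have := Nat.factorial_ne_zero (2 * j)
  push_cast
  have h3 : ((2 * j).factorial : ℝ) ≠ 0 := by exact_mod_cast this
  field_simp
  ring

lemma fG_odd (a ρ : ℝ) (ha : 0 < a) (j : ℕ) :
    fG a ρ (2 * j + 1) = Gamma (a + j + 1/2) ^ 2 / Gamma (a + j) ^ 2 * (2 * ρ / (2 * j + 1))
      * fG a ρ (2 * j) := by
  unfold fG
  have e1 : a + ((2 * j + 1 : ℕ) : ℝ) / 2 = (a + j) + 1/2 := by push_cast; ring
  have e2 : a + ((2 * j : ℕ) : ℝ) / 2 = a + j := by push_cast; ring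
  rw [e1, e2, Nat.factorial_succ]
  have h4 := (Gamma_pos_of_pos (show 0 < a + j by positivity)).ne'
  have h3 : ((2 * j).factorial : ℝ) ≠ 0 := by exact_mod_cast Nat.factorial_ne_zero (2 * j)
  push_cast
  field_simp
  ring

lemma fG_even_nonneg (a ρ : ℝ) (j : ℕ) : 0 ≤ fG a ρ (2 * j) := by
  unfold fG
  rw [pow_mul (2 * ρ) 2 j]
  positivity

lemma fG_summable (a ρ : ℝ) (ha : 0 < a) (hρ : |ρ| < 1) : Summable (fG a ρ) := by
  have hx : ρ ^ 2 < 1 := by rw [← sq_abs]; have := abs_nonneg ρ; nlinarith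
  have heven : Summable fun j : ℕ => fG a ρ (2 * j) := by
    have ht : Filter.Tendsto (fun j : ℕ => ((a + 1 * (j:ℝ)) / (1 + 2 * j)) *
        ((a + 1 * (j:ℝ)) / (2 + 2 * j)) * (4 * ρ ^ 2)) Filter.atTop
        (nhds (1 / 2 * (1 / 2) * (4 * ρ ^ 2))) :=
      ((tendsto_add_mul_div_add_mul_atTop_nhds a 1 1 (by norm_num)).mul
        (tendsto_add_mul_div_add_mul_atTop_nhds a 2 1 (by norm_num))).mul_const _
    have hlim : 1 / 2 * (1 / 2) * (4 * ρ ^ 2) < (1 + ρ ^ 2) / 2 := by linarith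
    apply summable_of_ratio_norm_eventually_le (r := (1 + ρ ^ 2) / 2) (by linarith)
    filter_upwards [ht.eventually (gt_mem_nhds hlim)] with j hj
    rw [fG_even_succ a ρ ha, norm_mul]
    gcongr
    rw [Real.norm_of_nonneg (by positivity)]
    refine le_trans (le_of_eq ?_) hj.le
    field_simp
    ring
  have hodd : Summable fun j : ℕ => fG a ρ (2 * j + 1) := by
    apply Summable.of_norm_bounded (heven.mul_left ((a + 1) * (2 * |ρ|)))
    intro j
    rw [fG_odd a ρ ha, norm_mul, Real.norm_of_nonneg (fG_even_nonneg a ρ j)]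
    apply mul_le_mul_of_nonneg_right _ (fG_even_nonneg a ρ j)
    have hp : 0 < a + j := by positivity
    have h1 : Gamma (a + j + 1/2) ^ 2 / Gamma (a + j) ^ 2 ≤ a + j := by
      have := Gamma_pos_of_pos hp
      rw [div_le_iff₀ (by positivity)]
      exact gamma_half_sq_le _ hp
    rw [norm_mul, Real.norm_of_nonneg (by positivity), norm_div, norm_mul]
    simp only [Real.norm_eq_abs]
    rw [abs_of_pos (show (0:ℝ) < 2 * j + 1 by positivity), abs_two]
    calc _ ≤ (a + j) * (2 * |ρ| / (2 * j + 1)) := by gcongr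
      _ = (a + j) / (2 * j + 1) * (2 * |ρ|) := by ring
      _ ≤ (a + 1) * (2 * |ρ|) := by
        gcongr
        rw [div_le_iff₀ (by positivity)]
        have : (0:ℝ) ≤ j := by positivity
        nlinarith [mul_nonneg ha.le this]
  exact (heven.hasSum.even_add_odd hodd.hasSum).summable

lemma weight_integrable (a : ℝ) (ha : 1 ≤ a) :
    IntegrableOn (fun r : ℝ => (1 - r ^ 2) ^ (a - 3/2)) (Set.Ioo (-1 : ℝ) 1) := by
  have h0 : IntegrableOn (fun r : ℝ => 1 / √(1 - r ^ 2)) (Set.Ioo (-1 : ℝ) 1) := by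
    have := intervalIntegral.integrableOn_deriv_of_nonneg (a := -1) (b := 1) (g := Real.arcsin)
      (g' := fun r : ℝ => 1 / √(1 - r ^ 2)) Real.continuous_arcsin.continuousOn
      (fun x hx => Real.hasDerivAt_arcsin (by have := hx.1; linarith) (by have := hx.2; linarith))
      (fun x hx => by positivity)
    exact this.mono_set Set.Ioo_subset_Ioc_self
  refine Integrable.mono' h0 ?_ ?_
  · exact (by fun_prop : Measurable fun r : ℝ => (1 - r ^ 2) ^ (a - 3/2)).aestronglyMeasurable
  · filter_upwards [ae_restrict_mem measurableSet_Ioo] with r hr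
    have h1 : 0 < 1 - r ^ 2 := by nlinarith [hr.1, hr.2]
    rw [Real.norm_of_nonneg (by positivity), Real.sqrt_eq_rpow, one_div, ← Real.rpow_neg h1.le]
    apply Real.rpow_le_rpow_of_exponent_ge h1 (by nlinarith) (by linarith)

lemma weight_pow_integrable (a : ℝ) (ha : 1 ≤ a) (j : ℕ) :
    IntegrableOn (fun r : ℝ => r ^ j * (1 - r ^ 2) ^ (a - 3/2)) (Set.Ioo (-1 : ℝ) 1) := by
  refine Integrable.mono' (weight_integrable a ha) ?_ ?_
  · exact (by fun_prop : Measurable fun r : ℝ => r ^ j * (1 - r ^ 2) ^ (a - 3/2)).aestronglyMeasurable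
  · filter_upwards [ae_restrict_mem measurableSet_Ioo] with r hr
    have h1 : 0 < 1 - r ^ 2 := by nlinarith [hr.1, hr.2]
    rw [norm_mul, Real.norm_of_nonneg (r := (1 - r ^ 2) ^ (a - 3/2)) (by positivity), norm_pow]
    apply mul_le_of_le_one_left (by positivity)
    apply pow_le_one₀ (norm_nonneg _)
    rw [Real.norm_eq_abs, abs_le]; exact ⟨hr.1.le, hr.2.le⟩

lemma fI_rec (a : ℝ) (ha : 1 ≤ a) (j : ℕ) : (j + 1) * fI a j = (j + 2 * a) * fI a (j + 2) := by
  have hder : ∀ r ∈ Set.Ioo (-1 : ℝ) 1, HasDerivAt (fun r : ℝ => r ^ (j + 1) * (1 - r ^ 2) ^ (a - 1/2))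
      ((j + 1) * (r ^ j * (1 - r ^ 2) ^ (a - 3/2)) -
        (j + 2 * a) * (r ^ (j + 2) * (1 - r ^ 2) ^ (a - 3/2))) r := by
    intro r hr
    have h1 : 0 < 1 - r ^ 2 := by nlinarith [hr.1, hr.2]
    have d1 : HasDerivAt (fun r : ℝ => 1 - r ^ 2) (-(2 * r)) r := by
      simpa using ((hasDerivAt_pow 2 r).const_sub 1)
    have d2 := d1.rpow_const (p := a - 1/2) (Or.inl h1.ne')
    have d3 := (hasDerivAt_pow (j + 1) r).mul d2
    refine HasDerivAt.congr_deriv d3 ?_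
    have e1 : (1 - r ^ 2) ^ (a - 1/2) = (1 - r ^ 2) * (1 - r ^ 2) ^ (a - 3/2) := by
      rw [← Real.rpow_one_add' h1.le (by linarith)]; congr 1; ring
    have e2 : a - 1/2 - 1 = a - 3/2 := by ring
    rw [e1, e2]
    push_cast
    ring
  have hi1 := (weight_pow_integrable a ha j).const_mul ((j:ℝ) + 1)
  have hi2 := (weight_pow_integrable a ha (j + 2)).const_mul ((j:ℝ) + 2 * a)
  have hint := hi1.sub hi2
  have hc : ContinuousOn (fun r : ℝ => r ^ (j + 1) * (1 - r ^ 2) ^ (a - 1/2)) (Set.Icc (-1) 1) := by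
    apply Continuous.continuousOn
    apply Continuous.mul (by fun_prop)
    apply Continuous.rpow_const (by fun_prop)
    intro x; right; linarith
  have := intervalIntegral.integral_eq_sub_of_hasDerivAt_of_le (by norm_num : (-1:ℝ) ≤ 1) hc hder (by
    rw [intervalIntegrable_iff_integrableOn_Ioo_of_le (by norm_num)]
    exact hint)
  rw [intervalIntegral.integral_of_le (by norm_num), integral_Ioc_eq_integral_Ioo,
    integral_sub hi1 hi2, integral_const_mul, integral_const_mul] at this
  have z : (0:ℝ) ^ (a - 1/2) = 0 := Real.zero_rpow (by linarith)
  norm_num at this z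
  rw [z] at this
  unfold fI
  norm_num
  linarith

lemma fI_odd (a : ℝ) (j : ℕ) : fI a (2 * j + 1) = 0 := by
  unfold fI
  rw [← integral_Ioc_eq_integral_Ioo, ← intervalIntegral.integral_of_le (by norm_num)]
  have := intervalIntegral.integral_comp_neg (a := -1) (b := 1)
    (fun r : ℝ => r ^ (2 * j + 1) * (1 - r ^ 2) ^ (a - 3/2))
  simp only [neg_neg] at this
  have e : ∀ r : ℝ, (-r) ^ (2 * j + 1) * (1 - (-r) ^ 2) ^ (a - 3/2)
      = - (r ^ (2 * j + 1) * (1 - r ^ 2) ^ (a - 3/2)) := fun r => by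
    rw [Odd.neg_pow ⟨j, rfl⟩, neg_sq]; ring
  simp_rw [e, intervalIntegral.integral_neg] at this
  linarith

lemma fI_even_nonneg (a : ℝ) (j : ℕ) : 0 ≤ fI a (2 * j) := by
  apply setIntegral_nonneg measurableSet_Ioo
  intro r hr
  have h1 : 0 < 1 - r ^ 2 := by nlinarith [hr.1, hr.2]
  rw [pow_mul]
  positivity

lemma moment_hasSum (a ρ C : ℝ) (ha : 1 ≤ a) (hρ : |ρ| < 1) (m : ℕ) :
    HasSum (fun k => C * fG a ρ k * fI a (k + m))
      (∫ r in Set.Ioo (-1 : ℝ) 1, r ^ m * (C * (1 - r ^ 2) ^ (a - 3/2) *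
        ∑' k : ℕ, fG a ρ k * r ^ k)) := by
  have hint : ∀ k : ℕ, Integrable (fun r : ℝ => C * fG a ρ k * (r ^ (k + m) * (1 - r ^ 2) ^ (a - 3/2)))
      (volume.restrict (Set.Ioo (-1 : ℝ) 1)) := fun k =>
    (weight_pow_integrable a ha (k + m)).const_mul _
  have hsum : Summable fun k : ℕ => ∫ r in Set.Ioo (-1 : ℝ) 1,
      ‖C * fG a ρ k * (r ^ (k + m) * (1 - r ^ 2) ^ (a - 3/2))‖ := by
    apply Summable.of_nonneg_of_le (fun k => integral_nonneg fun r => norm_nonneg _) _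
      (((fG_summable a ρ (by linarith) hρ).norm.mul_left ‖C‖).mul_right (fI a 0))
    intro k
    rw [fI, ← norm_mul, ← integral_const_mul]
    apply setIntegral_mono_on (hint k).norm ((weight_pow_integrable a ha 0).const_mul _)
      measurableSet_Ioo
    intro r hr
    have h1 : 0 < 1 - r ^ 2 := by nlinarith [hr.1, hr.2]
    rw [norm_mul, norm_mul (r ^ _), norm_pow,
      Real.norm_of_nonneg (r := (1 - r ^ 2) ^ (a - 3/2)) (by positivity)]
    gcongr
    rw [pow_zero]
    apply pow_le_one₀ (norm_nonneg _)
    rw [Real.norm_eq_abs, abs_le]; exact ⟨hr.1.le, hr.2.le⟩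
  have key := hasSum_integral_of_summable_integral_norm hint hsum
  simp_rw [integral_const_mul] at key
  have e : ∀ r : ℝ, r ^ m * (C * (1 - r ^ 2) ^ (a - 3/2) * ∑' k : ℕ, fG a ρ k * r ^ k) =
      ∑' k : ℕ, C * fG a ρ k * (r ^ (k + m) * (1 - r ^ 2) ^ (a - 3/2)) := ?_
  · simp_rw [e]; exact key
  intro r
  rw [← mul_assoc, ← tsum_mul_left]
  congr 1
  ext k
  ring

lemma bounds_of_series (a ρ C : ℝ) (ha : 1 ≤ a) (hρ : |ρ| < 1) (hC : 0 ≤ C) (M : ℕ → ℝ)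
    (hM : ∀ m, HasSum (fun k => C * fG a ρ k * fI a (k + m)) (M m)) (h0 : M 0 = 1) :
    (∃ H : ℝ, M 1 = ρ * H ∧ 1 - 1 / (4 * a) ≤ H ∧ H ≤ 1) ∧
      M 2 ≤ ρ ^ 2 * (1 - 1 / (2 * a)) + 1 / (2 * a) := by
  have ha0 : 0 < a := by linarith
  let w : ℕ → ℝ := fun j => C * fG a ρ (2 * j) * fI a (2 * j)
  have hw0 : ∀ j, 0 ≤ w j := fun j =>
    mul_nonneg (mul_nonneg hC (fG_even_nonneg a ρ j)) (fI_even_nonneg a j)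
  have inj : Function.Injective (fun j : ℕ => 2 * j) := fun x y h => by
    simp only at h; omega
  have inj' : Function.Injective (fun j : ℕ => 2 * j + 1) := fun x y h => by
    simp only at h; omega
  have hrec : ∀ j : ℕ, fI a (2 * j + 2) = (2 * j + 1) / (2 * j + 2 * a) * fI a (2 * j) := fun j => by
    have := fI_rec a ha (2 * j)
    push_cast at this
    rw [div_mul_eq_mul_div, eq_div_iff (by positivity)]
    linarith
  have hs0 : HasSum w 1 := by
    rw [← h0]
    refine (inj.hasSum_iff ?_).mpr (hM 0)
    intro k hk
    rcases Nat.even_or_odd' k with ⟨c, rfl | rfl⟩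
    · exact absurd ⟨c, rfl⟩ hk
    · simp [fI_odd]
  have hs1 : HasSum (fun j : ℕ => ρ * (w j * (Gamma (a + j + 1/2) ^ 2 / Gamma (a + j) ^ 2 / (a + j))))
      (M 1) := by
    have : HasSum ((fun k => C * fG a ρ k * fI a (k + 1)) ∘ (fun j : ℕ => 2 * j + 1)) (M 1) := by
      refine (inj'.hasSum_iff ?_).mpr (hM 1)
      intro k hk
      rcases Nat.even_or_odd' k with ⟨c, rfl | rfl⟩
      · simp [fI_odd]
      · exact absurd ⟨c, rfl⟩ hk
    convert this using 1
    ext j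
    have hp : (0:ℝ) < a + j := by positivity
    have hg := (Gamma_pos_of_pos hp).ne'
    simp only [Function.comp, w]
    rw [fG_odd a ρ ha0, show 2 * j + 1 + 1 = 2 * j + 2 by ring, hrec]
    have : (0:ℝ) < j + a := by positivity
    field_simp
    ring
  have hs2 : HasSum (fun j : ℕ => w j * ((2 * j + 1) / (2 * j + 2 * a))) (M 2) := by
    have : HasSum ((fun k => C * fG a ρ k * fI a (k + 2)) ∘ (fun j : ℕ => 2 * j)) (M 2) := by
      refine (inj.hasSum_iff ?_).mpr (hM 2)
      intro k hk
      rcases Nat.even_or_odd' k with ⟨c, rfl | rfl⟩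
      · exact absurd ⟨c, rfl⟩ hk
      · have := fI_odd a (c + 1)
        rw [show 2 * c + 1 + 2 = 2 * (c + 1) + 1 by ring, this, mul_zero]
    convert this using 1
    ext j
    simp only [Function.comp, w]
    rw [hrec]
    ring
  have hwrec : ∀ j : ℕ, w (j + 1) * (j + 1) = ρ ^ 2 * (a + j) * w j := fun j => by
    simp only [w]
    rw [fG_even_succ a ρ ha0, show 2 * (j + 1) = 2 * j + 2 by ring, hrec]
    have : (0:ℝ) < a + j := by positivity
    field_simp
    ring
  -- h bounds
  let h : ℕ → ℝ := fun j => Gamma (a + j + 1/2) ^ 2 / Gamma (a + j) ^ 2 / (a + j)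
  have hh1 : ∀ j, h j ≤ 1 := fun j => by
    have hp : (0:ℝ) < a + j := by positivity
    have hg := (Gamma_pos_of_pos hp)
    simp only [h]
    rw [div_le_one hp, div_le_iff₀ (by positivity)]
    exact gamma_half_sq_le _ hp
  have hh2 : ∀ j, 1 - 1 / (4 * a) ≤ h j := fun j => by
    have hp : (0:ℝ) < a + j := by positivity
    have hj : (0:ℝ) ≤ j := by positivity
    have hg := (Gamma_pos_of_pos hp)
    have h1 := gamma_watson (a + j) (by linarith)
    have h2 : a + j - 1/4 ≤ Gamma (a + j + 1/2) ^ 2 / Gamma (a + j) ^ 2 := by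
      rwa [le_div_iff₀ (by positivity)]
    simp only [h]
    rw [le_div_iff₀ hp]
    refine le_trans ?_ h2
    have e : 1 / (4 * a) * a = 1/4 := by field_simp
    have : 0 ≤ 1 / (4 * a) * j := by positivity
    nlinarith
  have hh0 : ∀ j, 0 ≤ h j := fun j => by
    have hp : (0:ℝ) < a + j := by positivity
    simp only [h]; positivity
  have hsh : Summable fun j => w j * h j :=
    Summable.of_nonneg_of_le (fun j => mul_nonneg (hw0 j) (hh0 j))
      (fun j => mul_le_of_le_one_right (hw0 j) (hh1 j)) hs0.summable
  refine ⟨⟨∑' j, w j * h j, ?_, ?_, ?_⟩, ?_⟩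
  · rw [← tsum_mul_left]; exact hs1.tsum_eq.symm
  · have := hasSum_le (fun j => mul_le_mul_of_nonneg_left (hh2 j) (hw0 j))
      (hs0.mul_right (1 - 1 / (4 * a))) hsh.hasSum
    linarith
  · exact hasSum_le (fun j => mul_le_of_le_one_right (hw0 j) (hh1 j)) hsh.hasSum hs0
  · -- second moment
    let g : ℕ → ℝ := fun j => w j * (j / (a + j))
    have hg0 : ∀ j, 0 ≤ g j := fun j => mul_nonneg (hw0 j) (by positivity)
    have hgs : Summable g := Summable.of_nonneg_of_le hg0
      (fun j => mul_le_of_le_one_right (hw0 j) (by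
        rw [div_le_one (by positivity)]; linarith)) hs0.summable
    have hg1 : ∑' j, g j ≤ ρ ^ 2 := by
      rw [hgs.tsum_eq_zero_add]
      have z : g 0 = 0 := by simp [g]
      rw [z, zero_add]
      have hb : HasSum (fun j => ρ ^ 2 * w j) (ρ ^ 2 * 1) := hs0.mul_left _
      rw [mul_one] at hb
      refine hasSum_le (fun j => ?_) ((summable_nat_add_iff 1).mpr hgs).hasSum hb
      simp only [g]
      push_cast
      rw [← mul_div_assoc, hwrec, div_le_iff₀ (by positivity)]
      have : 0 ≤ ρ ^ 2 * w j := mul_nonneg (sq_nonneg _) (hw0 j)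
      nlinarith
    have hM2 : HasSum (fun j : ℕ => w j * ((2 * j + 1) / (2 * j + 2 * a)))
        ((∑' j, g j) * (1 - 1 / (2 * a)) + 1 * (1 / (2 * a))) := by
      have hh := (hgs.hasSum.mul_right (1 - 1 / (2 * a))).add (hs0.mul_right (1 / (2 * a)))
      refine hh.congr_fun ?_
      intro j
      simp only [g]
      have : (0:ℝ) < a + j := by positivity
      field_simp
      ring
    rw [hs2.unique hM2]
    have : 0 ≤ 1 - 1 / (2 * a) := by
      rw [sub_nonneg, div_le_one (by positivity)]; linarith
    nlinarith

lemma fisher_eq (n : ℕ) (ρ r : ℝ) :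
    fisherDensity n ρ r = Set.indicator (Set.Ioo (-1 : ℝ) 1) (fun r =>
      2 ^ ((n : ℝ) - 3) * (1 - ρ ^ 2) ^ (((n : ℝ) - 1) / 2) / (π * Gamma ((n : ℝ) - 2)) *
        (1 - r ^ 2) ^ (((n : ℝ) - 1) / 2 - 3/2) *
        ∑' k : ℕ, fG (((n : ℝ) - 1) / 2) ρ k * r ^ k) r := by
  unfold fisherDensity
  by_cases hr : |r| < 1
  · rw [if_pos hr, Set.indicator_of_mem (show r ∈ Set.Ioo (-1 : ℝ) 1 from abs_lt.mp hr)]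
    have e1 : ((n : ℝ) - 1) / 2 - 3/2 = ((n : ℝ) - 4) / 2 := by ring
    have e2 : ∀ k : ℕ, fG (((n : ℝ) - 1) / 2) ρ k * r ^ k =
      (Gamma (((n : ℝ) - 1 + (k : ℝ)) / 2)) ^ 2 * (2 * r * ρ) ^ k / (Nat.factorial k : ℝ) := by
      intro k
      unfold fG
      rw [← add_div, show 2 * r * ρ = (2 * ρ) * r by ring, mul_pow (2 * ρ) r]
      ring
    simp_rw [e1, e2]
    ring
  · rw [if_neg hr, Set.indicator_of_notMem (show r ∉ Set.Ioo (-1 : ℝ) 1 from fun h => hr (abs_lt.mpr h))]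

lemma fisher_nonneg (n : ℕ) (hn : 3 ≤ n) (ρ : ℝ) (hρ : |ρ| < 1) (r : ℝ) :
    0 ≤ fisherDensity n ρ r := by
  have hn' : (3:ℝ) ≤ n := by exact_mod_cast hn
  rw [fisher_eq]
  apply Set.indicator_nonneg
  intro r hr
  have h1 : 0 < 1 - r ^ 2 := by nlinarith [hr.1, hr.2]
  have h2 : 0 < 1 - ρ ^ 2 := by have := abs_lt.mp hρ; nlinarith [this.1, this.2]
  have h3 := Gamma_pos_of_pos (show (0:ℝ) < n - 2 by linarith)
  have h4 := fisher_series_nonneg (((n : ℝ) - 1) / 2) (by linarith) (2 * ρ * r)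
  have e2 : ∀ k : ℕ, fG (((n : ℝ) - 1) / 2) ρ k * r ^ k =
      Gamma (((n : ℝ) - 1) / 2 + k / 2) ^ 2 * (2 * ρ * r) ^ k / (Nat.factorial k : ℝ) := by
    intro k
    unfold fG
    rw [mul_pow (2 * ρ) r]
    ring
  simp_rw [e2]
  exact mul_nonneg (by positivity) h4

lemma fisher_measurable (n : ℕ) (hn : 3 ≤ n) (ρ : ℝ) (hρ : |ρ| < 1) :
    Measurable (fisherDensity n ρ) := by
  have hn' : (3:ℝ) ≤ n := by exact_mod_cast hn
  set a : ℝ := ((n : ℝ) - 1) / 2 with ha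
  have e : fisherDensity n ρ = fun r =>
      (2 ^ ((n : ℝ) - 3) * (1 - ρ ^ 2) ^ a / (π * Gamma ((n : ℝ) - 2)) * (1 - r ^ 2) ^ (a - 3/2)) *
      (Set.indicator (Set.Ioo (-1 : ℝ) 1) (fun r => ∑' k : ℕ, fG a ρ k * r ^ k) r) := by
    ext r
    rw [fisher_eq]
    by_cases hr : r ∈ Set.Ioo (-1 : ℝ) 1
    · rw [Set.indicator_of_mem hr, Set.indicator_of_mem hr]
    · rw [Set.indicator_of_notMem hr, Set.indicator_of_notMem hr, mul_zero]
  rw [e]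
  apply Measurable.mul (by fun_prop)
  refine measurable_of_tendsto_metrizable (f := fun (N : ℕ) =>
    Set.indicator (Set.Ioo (-1 : ℝ) 1) (fun r => ∑ k ∈ Finset.range N, fG a ρ k * r ^ k)) ?_ ?_
  · intro N
    exact Measurable.indicator (by fun_prop) measurableSet_Ioo
  · rw [tendsto_pi_nhds]
    intro r
    by_cases hr : r ∈ Set.Ioo (-1 : ℝ) 1
    · simp only [Set.indicator_of_mem hr]
      apply HasSum.tendsto_sum_nat
      apply Summable.hasSum
      apply Summable.of_norm_bounded (fG_summable a ρ (by rw [ha]; linarith) hρ).norm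
      intro k
      rw [norm_mul, norm_pow]
      apply mul_le_of_le_one_right (norm_nonneg _)
      apply pow_le_one₀ (norm_nonneg _)
      rw [Real.norm_eq_abs, abs_le]; exact ⟨hr.1.le, hr.2.le⟩
    · simp only [Set.indicator_of_notMem hr]
      exact tendsto_const_nhds

/-- Chebyshev-type concentration for the sample correlation coefficient:
`R = ρ + O_P(n^{-1/2})`. -/
theorem corr_chebyshev_concentration {Ω : Type*} [MeasurableSpace Ω] (P : Measure Ω)
    [IsProbabilityMeasure P] (n : ℕ) (hn : 3 ≤ n) (ρ : ℝ) (hρ : ρ ∈ Set.Ioo (-1 : ℝ) 1)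
    (R : Ω → ℝ) (hR : Measurable R)
    (hlaw : Measure.map R P = volume.withDensity fun r => ENNReal.ofReal (fisherDensity n ρ r))
    (t : ℝ) (ht : |ρ| / (n : ℝ) < t) :
    P {ω | t < |R ω - ρ|} ≤
      ENNReal.ofReal (1 / (((n : ℝ) - 1) * (t - |ρ| / (n : ℝ)) ^ 2)) := by
  have hn' : (3:ℝ) ≤ n := by exact_mod_cast hn
  have hρ' : |ρ| < 1 := abs_lt.mpr hρ
  have hfm := fisher_measurable n hn ρ hρ'
  have hf0 := fisher_nonneg n hn ρ hρ'
  set a : ℝ := ((n : ℝ) - 1) / 2 with ha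
  have ha1 : 1 ≤ a := by rw [ha]; linarith
  set C : ℝ := 2 ^ ((n : ℝ) - 3) * (1 - ρ ^ 2) ^ a / (π * Gamma ((n : ℝ) - 2)) with hCdef
  have hC : 0 ≤ C := by
    have h2 : 0 < 1 - ρ ^ 2 := by nlinarith [hρ.1, hρ.2]
    have h3 := Gamma_pos_of_pos (show (0:ℝ) < n - 2 by linarith)
    positivity
  have hmom : ∀ m : ℕ, ∫ ω, R ω ^ m ∂P = ∫ r in Set.Ioo (-1 : ℝ) 1, r ^ m *
      (C * (1 - r ^ 2) ^ (a - 3/2) * ∑' k : ℕ, fG a ρ k * r ^ k) := by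
    intro m
    rw [← integral_map (φ := R) (f := fun r : ℝ => r ^ m) hR.aemeasurable
      (by fun_prop : Measurable fun r : ℝ => r ^ m).aestronglyMeasurable, hlaw,
      integral_withDensity_eq_integral_toReal_smul hfm.ennreal_ofReal (by simp),
      ← integral_indicator measurableSet_Ioo]
    congr 1
    ext r
    rw [ENNReal.toReal_ofReal (hf0 r), smul_eq_mul, fisher_eq]
    by_cases hr : r ∈ Set.Ioo (-1 : ℝ) 1
    · rw [Set.indicator_of_mem hr, Set.indicator_of_mem hr]; ring
    · rw [Set.indicator_of_notMem hr, Set.indicator_of_notMem hr, zero_mul]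
  have hM : ∀ m, HasSum (fun k => C * fG a ρ k * fI a (k + m)) (∫ ω, R ω ^ m ∂P) := fun m => by
    rw [hmom]; exact moment_hasSum a ρ C ha1 hρ' m
  obtain ⟨⟨H, hm1, hH1, hH2⟩, hm2⟩ := bounds_of_series a ρ C ha1 hρ' hC _ hM (by simp)
  simp only [pow_one] at hm1
  have hbd : ∀ᵐ ω ∂P, ‖R ω‖ ≤ 1 := by
    have : ∀ᵐ r ∂(Measure.map R P), ‖r‖ ≤ 1 := by
      rw [hlaw, ae_withDensity_iff hfm.ennreal_ofReal]
      refine Filter.Eventually.of_forall fun r hr => ?_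
      by_contra hc
      apply hr
      have : ¬ |r| < 1 := by rw [Real.norm_eq_abs] at hc; linarith
      simp [fisherDensity, this]
    exact ae_of_ae_map hR.aemeasurable this
  have hL2 : MemLp R 2 P := MemLp.of_bound hR.aestronglyMeasurable 1 hbd
  have hvar : ProbabilityTheory.variance R P ≤ 1 / ((n:ℝ) - 1) := by
    rw [ProbabilityTheory.variance_eq_sub hL2]
    have e1 : 1 / (2 * a) = 1 / ((n:ℝ) - 1) := by rw [ha]; congr 1; ring
    have e2 : 1 / (4 * a) = 1 / ((n:ℝ) - 1) / 2 := by
      rw [← e1]; field_simp; norm_num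
    rw [e1] at hm2
    rw [e2] at hH1
    set u := 1 / ((n:ℝ) - 1) with hu
    have hu0 : 0 ≤ u := by rw [hu]; apply div_nonneg <;> linarith
    have hu1 : u ≤ 1 := by rw [hu, div_le_one] <;> linarith
    simp only [Pi.pow_apply]
    rw [hm1]
    have : 1 - u ≤ H ^ 2 := by nlinarith
    nlinarith [mul_le_mul_of_nonneg_left this (sq_nonneg ρ)]
  have hbias : |(∫ ω, R ω ∂P) - ρ| ≤ |ρ| / n := by
    rw [hm1, show ρ * H - ρ = ρ * (H - 1) by ring, abs_mul, div_eq_mul_inv]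
    gcongr
    rw [abs_le]
    have h1 : 1 / (4 * a) ≤ (n:ℝ)⁻¹ := by
      rw [← one_div]
      apply one_div_le_one_div_of_le (by linarith)
      rw [ha]; linarith
    have : 0 ≤ (n:ℝ)⁻¹ := by positivity
    constructor <;> linarith
  have hs : 0 < t - |ρ| / n := by linarith
  calc P {ω | t < |R ω - ρ|} ≤ P {ω | t - |ρ| / n ≤ |R ω - ∫ ω, R ω ∂P|} := by
        apply measure_mono
        intro ω hω
        simp only [Set.mem_ofPred_eq] at hω ⊢
        have := abs_sub_le (R ω) (∫ ω, R ω ∂P) ρ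
        linarith
    _ ≤ ENNReal.ofReal (ProbabilityTheory.variance R P / (t - |ρ| / n) ^ 2) :=
        ProbabilityTheory.meas_ge_le_variance_div_sq hL2 hs
    _ ≤ _ := by
        apply ENNReal.ofReal_le_ofReal
        rw [← div_div]
        gcongr
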